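/- Let p be a prime, let α₁,...,α_N be a finite sequence in ℤ_p, and define f : ℤ_p × ℤ_p → ℝ by f(x,y) = #{n ≤ N : α_n ∈ D(x,|y|_p)}/N − |y|_p. Suppose (x₀,y₀) ∈ ℤ_p × ℤ_p satisfies f(x₀,y₀) > 0, and set Δ = f(x₀,y₀). Then ∬_{ℤ_p×ℤ_p} |f(x,y)|² dμ(x) dμ(y) ≥ ((p−1)³/p⁹)·Δ⁴. -/

import Mathlib

open MeasureTheory Filter Finset
open scoped Classical

noncomputable section

/-- The Prüfer `p`-group `ℤ(p^∞)`: the set of all `p`-power roots of unity in `ℂ`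
(a multiplicative group). -/
def prufer (p : ℕ) : Set ℂ := {z : ℂ | ∃ n : ℕ, z ^ p ^ n = 1}

/-- For a `p`-power root of unity `ζ` of order `p^j` and `x ∈ ℤ_p` with canonical expansion
`x = a₀ + a₁ p + a₂ p² + ...`, this is `ζ^x := ζ^(a₀ + a₁ p + ... + a_{j-1} p^{j-1})`.
(Here `x.appr n = a₀ + a₁ p + ... + a_{n-1} p^{n-1}`; since `orderOf ζ = p^j ≥ j`, the
exponent `x.appr (orderOf ζ)` is congruent to the truncation `a₀ + ... + a_{j-1} p^{j-1}`
modulo `p^j = orderOf ζ`, so this agrees with the paper's definition.) -/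
def pruferChar (p : ℕ) [Fact p.Prime] (ζ : ℂ) (x : ℤ_[p]) : ℂ :=
  ζ ^ (x.appr (orderOf ζ))

/-- The discrepancy `D_N` of the finite sequence `α 1, ..., α N` in `ℤ_p`:
`D_N = sup_{a ∈ ℤ_p, k ∈ ℕ} | #{1 ≤ n ≤ N : αₙ ∈ D(a, 1/p^k)} / N - 1/p^k |`,
where `D(a, 1/p^k) = {z : |z - a|_p ≤ p^{-k}}`. -/
def disc (p : ℕ) [Fact p.Prime] (N : ℕ) (α : ℕ → ℤ_[p]) : ℝ :=
  ⨆ (a : ℤ_[p]) (k : ℕ),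
    |(((Finset.Icc 1 N).filter fun n => ‖α n - a‖ ≤ (p : ℝ) ^ (-(k : ℤ))).card : ℝ) / N
      - (p : ℝ) ^ (-(k : ℤ))|

/-- The local discrepancy function `f(x, y) = #{1 ≤ n ≤ N : αₙ ∈ D(x, |y|_p)} / N - |y|_p`. -/
def discFun (p : ℕ) [Fact p.Prime] (N : ℕ) (α : ℕ → ℤ_[p]) (x y : ℤ_[p]) : ℝ :=
  (((Finset.Icc 1 N).filter fun n => ‖α n - x‖ ≤ ‖y‖).card : ℝ) / N - ‖y‖

/-- A sequence `α` is equidistributed in `ℤ_p` if for every disc `D(a, 1/p^k)` the proportion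
of the first `N` terms lying in the disc tends to `1/p^k`. -/
def Equidistributed (p : ℕ) [Fact p.Prime] (α : ℕ → ℤ_[p]) : Prop :=
  ∀ (a : ℤ_[p]) (k : ℕ),
    Tendsto (fun N : ℕ =>
        |(((Finset.Icc 1 N).filter fun n => ‖α n - a‖ ≤ (p : ℝ) ^ (-(k : ℤ))).card : ℝ) / N
          - (p : ℝ) ^ (-(k : ℤ))|)
      atTop (nhds 0)

instance (p : ℕ) [Fact p.Prime] : MeasurableSpace ℤ_[p] := borel _
instance (p : ℕ) [Fact p.Prime] : BorelSpace ℤ_[p] := ⟨rfl⟩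

/-- The discs of radius `p ^ (-k)` have Haar measure `p ^ (-k)`. -/
lemma measureReal_norm_sub_le_pow (p : ℕ) [Fact p.Prime] (μ : Measure ℤ_[p])
    [μ.IsAddHaarMeasure] [IsProbabilityMeasure μ] (a : ℤ_[p]) (k : ℕ) :
    μ.real {z | ‖z - a‖ ≤ (p : ℝ) ^ (-(k : ℤ))} = (p : ℝ) ^ (-(k : ℤ)) := by
  let H : AddSubgroup ℤ_[p] :=
    (PadicInt.toZModPow k : ℤ_[p] →+* ZMod (p ^ k)).toAddMonoidHom.ker
  have hH : (H : Set ℤ_[p]) = {z | ‖z‖ ≤ (p : ℝ) ^ (-(k : ℤ))} := by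
    ext z
    have h₁ : z ∈ H ↔ z ∈ RingHom.ker (PadicInt.toZModPow k : ℤ_[p] →+* ZMod (p ^ k)) := Iff.rfl
    rw [SetLike.mem_coe, h₁, PadicInt.ker_toZModPow, Set.mem_ofPred_eq,
      PadicInt.norm_le_pow_iff_mem_span_pow]
  have hp : (p : ℝ) ≠ 0 := by exact_mod_cast (Fact.out : p.Prime).ne_zero
  have : NeZero (p ^ k) := ⟨pow_ne_zero k (Fact.out : p.Prime).ne_zero⟩
  have hindex : H.index = p ^ k := by
    rw [AddSubgroup.index_ker, AddMonoidHom.range_eq_top.mpr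
      (ZMod.ringHom_surjective (PadicInt.toZModPow k : ℤ_[p] →+* ZMod (p ^ k)))]
    simp
  have : H.FiniteIndex := ⟨by rw [hindex]; exact NeZero.ne _⟩
  have hmeas : MeasurableSet (H : Set ℤ_[p]) := by
    rw [hH]
    exact (isClosed_le continuous_norm continuous_const).measurableSet
  have hmul := congrArg ENNReal.toReal (AddSubgroup.index_mul_measure H hmeas μ)
  rw [hindex, hH, measure_univ, ENNReal.toReal_mul, ENNReal.toReal_natCast, ENNReal.toReal_one,
    Nat.cast_pow] at hmul
  have htrans : μ {z | ‖z - a‖ ≤ (p : ℝ) ^ (-(k : ℤ))} = μ {z | ‖z‖ ≤ (p : ℝ) ^ (-(k : ℤ))} := by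
    simpa only [sub_eq_add_neg, Set.preimage_ofPred_eq] using
      measure_preimage_add_right μ (-a) {z | ‖z‖ ≤ (p : ℝ) ^ (-(k : ℤ))}
  rw [measureReal_def, htrans, zpow_neg, zpow_natCast]
  exact eq_inv_of_mul_eq_one_right (by simpa only [zpow_neg, zpow_natCast] using hmul)

/-- The sphere of radius `p ^ (-k)` centred at `0` has Haar measure `p ^ (-k) * (1 - 1 / p)`. -/
lemma measureReal_norm_eq_pow (p : ℕ) [Fact p.Prime] (μ : Measure ℤ_[p])
    [μ.IsAddHaarMeasure] [IsProbabilityMeasure μ] (k : ℕ) :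
    μ.real {z | ‖z‖ = (p : ℝ) ^ (-(k : ℤ))} = (p : ℝ) ^ (-(k : ℤ)) * (1 - 1 / p) := by
  have hp : (1 : ℝ) < p := by exact_mod_cast (Fact.out : p.Prime).one_lt
  have hset : {z : ℤ_[p] | ‖z‖ = (p : ℝ) ^ (-(k : ℤ))} =
      {z | ‖z - 0‖ ≤ (p : ℝ) ^ (-(k : ℤ))} \ {z | ‖z - 0‖ ≤ (p : ℝ) ^ (-((k + 1 : ℕ) : ℤ))} := by
    ext z
    simp only [sub_zero, Set.mem_sdiff, Set.mem_ofPred_eq]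
    rw [PadicInt.norm_le_pow_iff_norm_lt_pow_add_one z (-((k + 1 : ℕ) : ℤ))]
    push_cast
    rw [neg_add_rev, neg_add_cancel_comm, not_lt, le_antisymm_iff]
  rw [hset, measureReal_sdiff, measureReal_norm_sub_le_pow, measureReal_norm_sub_le_pow]
  · push_cast
    rw [neg_add, zpow_add₀ (by positivity), zpow_neg_one]
    ring
  · intro z hz
    refine le_trans (Set.mem_ofPred_eq ▸ hz) ?_
    exact zpow_le_zpow_right₀ hp.le (by push_cast; linarith)
  · exact (isClosed_le (by fun_prop) continuous_const).measurableSet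

lemma measurable_uncurry_discFun (p : ℕ) [Fact p.Prime] (N : ℕ) (α : ℕ → ℤ_[p]) :
    Measurable fun z : ℤ_[p] × ℤ_[p] => discFun p N α z.1 z.2 := by
  simp only [discFun, Finset.card_filter, Nat.cast_sum]
  refine Measurable.sub (Measurable.div_const (Finset.measurable_sum _ fun n _ => ?_) _)
    (by fun_prop)
  push_cast
  exact Measurable.ite (isClosed_le (by fun_prop) (by fun_prop)).measurableSet
    measurable_const measurable_const

lemma discFun_le_one_sub (p : ℕ) [Fact p.Prime] (N : ℕ) (α : ℕ → ℤ_[p]) (x y : ℤ_[p]) :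
    discFun p N α x y ≤ 1 - ‖y‖ := by
  refine sub_le_sub_right (div_le_one_of_le₀ ?_ (Nat.cast_nonneg N)) _
  exact_mod_cast (Finset.card_filter_le _ _).trans (by simp)

lemma abs_discFun_le_one (p : ℕ) [Fact p.Prime] (N : ℕ) (α : ℕ → ℤ_[p]) (x y : ℤ_[p]) :
    |discFun p N α x y| ≤ 1 := by
  refine abs_le.mpr ⟨?_, (discFun_le_one_sub p N α x y).trans (by simp)⟩
  have hcard : 0 ≤ (((Finset.Icc 1 N).filter fun n => ‖α n - x‖ ≤ ‖y‖).card : ℝ) / N := by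
    positivity
  have hy := PadicInt.norm_le_one y
  unfold discFun
  linarith

/-- Enlarging a disc costs at most the increase of its radius. -/
lemma discFun_add_norm_le (p : ℕ) [Fact p.Prime] (N : ℕ) (α : ℕ → ℤ_[p]) {x₀ y₀ x y : ℤ_[p]}
    (hy : ‖y₀‖ ≤ ‖y‖) (hx : ‖x - x₀‖ ≤ ‖y‖) :
    discFun p N α x₀ y₀ + ‖y₀‖ ≤ discFun p N α x y + ‖y‖ := by
  simp only [discFun, sub_add_cancel]
  refine div_le_div_of_nonneg_right (Nat.cast_le.mpr (Finset.card_le_card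
    (Finset.monotone_filter_right _ fun n _ hα => ?_))) (Nat.cast_nonneg N)
  rw [← sub_sub_sub_cancel_right _ _ x₀, sub_eq_add_neg]
  refine (PadicInt.nonarchimedean _ _).trans (max_le (hα.trans hy) ?_)
  rwa [norm_neg]

/-- The contribution of a single radius `p ^ (-k)` to the `L²` norm of the local discrepancy. -/
lemma sq_mul_le_integral_discFun (p : ℕ) [Fact p.Prime] (μ : Measure ℤ_[p])
    [μ.IsAddHaarMeasure] [IsProbabilityMeasure μ] (N : ℕ) (α : ℕ → ℤ_[p]) (x₀ y₀ : ℤ_[p]) (k : ℕ)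
    (hk : ‖y₀‖ ≤ (p : ℝ) ^ (-(k : ℤ)))
    (hle : (p : ℝ) ^ (-(k : ℤ)) ≤ discFun p N α x₀ y₀ + ‖y₀‖) :
    (discFun p N α x₀ y₀ + ‖y₀‖ - (p : ℝ) ^ (-(k : ℤ))) ^ 2 *
        ((p : ℝ) ^ (-(k : ℤ)) * ((p : ℝ) ^ (-(k : ℤ)) * (1 - 1 / p)))
      ≤ ∫ x, ∫ y, |discFun p N α x y| ^ 2 ∂μ ∂μ := by
  set r := (p : ℝ) ^ (-(k : ℤ)) with hr
  set c := (discFun p N α x₀ y₀ + ‖y₀‖ - r) ^ 2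
  let F : ℤ_[p] × ℤ_[p] → ℝ := fun z => |discFun p N α z.1 z.2| ^ 2
  have hFint : Integrable F (μ.prod μ) := by
    refine Integrable.of_bound
      ((measurable_uncurry_discFun p N α).abs.pow_const 2).aestronglyMeasurable 1 ?_
    refine Eventually.of_forall fun z => ?_
    rw [Real.norm_of_nonneg (by positivity)]
    exact pow_le_one₀ (abs_nonneg _) (abs_discFun_le_one p N α z.1 z.2)
  let S : Set (ℤ_[p] × ℤ_[p]) := {x | ‖x - x₀‖ ≤ r} ×ˢ {y | ‖y‖ = r}
  have hS : MeasurableSet S :=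
    (isClosed_le (by fun_prop) continuous_const).measurableSet.prod
      (isClosed_eq continuous_norm continuous_const).measurableSet
  have hμS : (μ.prod μ).real S = r * (r * (1 - 1 / p)) := by
    rw [measureReal_prod_prod, measureReal_norm_sub_le_pow, measureReal_norm_eq_pow]
  have hmono : ∫ z, S.indicator (fun _ => c) z ∂(μ.prod μ) ≤ ∫ z, F z ∂(μ.prod μ) := by
    refine integral_mono ((integrable_const c).indicator hS) hFint fun z => ?_
    by_cases hz : z ∈ S
    · obtain ⟨hx, hy⟩ := hz
      rw [Set.mem_ofPred_eq] at hx hy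
      have hlow := discFun_add_norm_le p N α (hk.trans hy.ge) (hx.trans hy.ge)
      rw [hy] at hlow
      rw [Set.indicator_of_mem (show z ∈ S from ⟨hx, hy⟩)]
      exact pow_le_pow_left₀ (by linarith)
        ((show _ ≤ discFun p N α z.1 z.2 by linarith).trans (le_abs_self _)) 2
    · rw [Set.indicator_of_notMem hz]
      exact pow_nonneg (abs_nonneg _) 2
  rw [integral_indicator_const _ hS, hμS, integral_prod _ hFint, smul_eq_mul, mul_comm] at hmono
  exact hmono

/-- Case 1 of Lemma 3.1: if `f(x₀,y₀) > 0`, where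
`f(x,y) = #{n ≤ N : αₙ ∈ D(x,|y|_p)}/N - |y|_p`, and `Δ = f(x₀,y₀)`, then
`∬ |f(x,y)|² dμ(x) dμ(y) ≥ ((p-1)³/p⁹) Δ⁴`. -/
theorem l2_lower_bound_positive_case (p : ℕ) [Fact p.Prime] (μ : Measure ℤ_[p])
    [μ.IsAddHaarMeasure] [IsProbabilityMeasure μ]
    (N : ℕ) (hN : 1 ≤ N) (α : ℕ → ℤ_[p]) (x₀ y₀ : ℤ_[p])
    (h : 0 < discFun p N α x₀ y₀) :
    (((p : ℝ) - 1) ^ 3 / (p : ℝ) ^ 9) * (discFun p N α x₀ y₀) ^ 4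
      ≤ ∫ x, ∫ y, |discFun p N α x y| ^ 2 ∂μ ∂μ := by
  have hp : (2 : ℝ) ≤ p := by exact_mod_cast (Fact.out : p.Prime).two_le
  have hp0 : (0 : ℝ) < p := by linarith
  set Δ := discFun p N α x₀ y₀ with hΔ
  have hΔ1 : Δ ≤ 1 := (discFun_le_one_sub p N α x₀ y₀).trans (by simp)
  have hcoef : 0 ≤ 1 - 1 / (p : ℝ) := by
    rw [sub_nonneg, div_le_one hp0]
    linarith
  by_cases hy : Δ / (p : ℝ) ^ 2 ≤ ‖y₀‖
  · have hne : y₀ ≠ 0 := by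
      rintro rfl
      rw [norm_zero] at hy
      exact absurd hy (not_le.mpr (by positivity))
    have hnorm := PadicInt.norm_eq_zpow_neg_valuation hne
    refine le_trans ?_ (sq_mul_le_integral_discFun p μ N α x₀ y₀ y₀.valuation hnorm.le
      (by rw [← hnorm]; linarith))
    rw [← hnorm, ← hΔ, add_sub_cancel_right]
    calc ((p : ℝ) - 1) ^ 3 / (p : ℝ) ^ 9 * Δ ^ 4
        = Δ ^ 2 * (Δ / (p : ℝ) ^ 2 * (Δ / (p : ℝ) ^ 2 * (1 - 1 / p))) *
            (((p : ℝ) - 1) ^ 2 / (p : ℝ) ^ 4) := by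
          field_simp
      _ ≤ Δ ^ 2 * (Δ / (p : ℝ) ^ 2 * (Δ / (p : ℝ) ^ 2 * (1 - 1 / p))) := by
          refine mul_le_of_le_one_right (by positivity) ?_
          rw [div_le_one (by positivity)]
          nlinarith [sq_nonneg ((p : ℝ) ^ 2 - 1)]
      _ ≤ Δ ^ 2 * (‖y₀‖ * (‖y₀‖ * (1 - 1 / p))) := by gcongr
  · obtain ⟨n, hn₁, hn₂⟩ := exists_nat_pow_near_of_lt_one (x := Δ / p) (y := (p : ℝ)⁻¹)
      (by positivity) (by rw [div_le_one hp0]; linarith) (by positivity)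
      (inv_lt_one_of_one_lt₀ (by linarith))
    have hr : (p : ℝ) ^ (-((n + 1 : ℕ) : ℤ)) = (p : ℝ)⁻¹ ^ (n + 1) := by
      rw [zpow_neg, zpow_natCast, inv_pow]
    have hlow : Δ / (p : ℝ) ^ 2 ≤ (p : ℝ)⁻¹ ^ (n + 1) := by
      calc Δ / (p : ℝ) ^ 2 = Δ / p * (p : ℝ)⁻¹ := by field_simp
        _ ≤ (p : ℝ)⁻¹ ^ n * (p : ℝ)⁻¹ := by gcongr
        _ = (p : ℝ)⁻¹ ^ (n + 1) := (pow_succ _ _).symm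
    have hgap : Δ * (1 - 1 / p) ≤ Δ + ‖y₀‖ - (p : ℝ)⁻¹ ^ (n + 1) := by
      have hy0 := norm_nonneg y₀
      have hexp : Δ * (1 - 1 / p) = Δ - Δ / p := by ring
      linarith
    have hgap0 : 0 ≤ Δ * (1 - 1 / p) := by positivity
    refine le_trans ?_ (sq_mul_le_integral_discFun p μ N α x₀ y₀ (n + 1)
      (by rw [hr]; exact (not_le.mp hy).le.trans hlow) (by rw [hr]; linarith))
    rw [hr, ← hΔ]
    calc ((p : ℝ) - 1) ^ 3 / (p : ℝ) ^ 9 * Δ ^ 4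
        = (Δ * (1 - 1 / p)) ^ 2 * (Δ / (p : ℝ) ^ 2 * (Δ / (p : ℝ) ^ 2 * (1 - 1 / p))) *
            (1 / (p : ℝ) ^ 2) := by
          field_simp
      _ ≤ (Δ * (1 - 1 / p)) ^ 2 * (Δ / (p : ℝ) ^ 2 * (Δ / (p : ℝ) ^ 2 * (1 - 1 / p))) := by
          refine mul_le_of_le_one_right (by positivity) ?_
          rw [div_le_one (by positivity)]
          nlinarith
      _ ≤ (Δ + ‖y₀‖ - (p : ℝ)⁻¹ ^ (n + 1)) ^ 2 *
            ((p : ℝ)⁻¹ ^ (n + 1) * ((p : ℝ)⁻¹ ^ (n + 1) * (1 - 1 / p))) := by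
          gcongr
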